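/- arXiv:1306.1270 — 2 statements merged into one kernel-verified Lean document; each statement's English description precedes it below -/
import Mathlib

section
/- If Q is a countable Borel quasi-order on a Polish space X (i.e., Q is Borel as a subset of X² and every x has only countably many Q-predecessors), then there exists a countable monoid M acting on X in a Borel way such that x Q y if and only if there exists m in M with x = m·y. -/
open Set Filter Topology MeasureTheory

namespace FMQ

lemma analytic_inter {α : Type*} [TopologicalSpace α] [T2Space α] {s t : Set α}
    (hs : AnalyticSet s) (ht : AnalyticSet t) : AnalyticSet (s ∩ t) := by
  rw [inter_eq_iInter]
  exact AnalyticSet.iInter (fun b => by cases b <;> assumption)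

/-- The sigma-ideal of countable unions of Borel sets on which `f` is injective. -/
def Small {Z X : Type*} [MeasurableSpace Z] (f : Z → X) (A : Set Z) : Prop :=
  ∃ S : Set (Set Z), S.Countable ∧ (∀ B ∈ S, MeasurableSet B ∧ InjOn f B) ∧ A = ⋃₀ S

lemma Small.iUnion {Z X ι : Type*} [Countable ι] [MeasurableSpace Z] {f : Z → X} {A : ι → Set Z}
    (h : ∀ i, Small f (A i)) : Small f (⋃ i, A i) := by
  choose S hc hS hA using h
  refine ⟨⋃ i, S i, countable_iUnion hc, ?_, ?_⟩
  · intro B hB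
    obtain ⟨i, hi⟩ := mem_iUnion.1 hB
    exact hS i B hi
  · rw [sUnion_iUnion]
    exact iUnion_congr hA

lemma Small.measurable {Z X : Type*} [MeasurableSpace Z] {f : Z → X} {A : Set Z}
    (h : Small f A) : MeasurableSet A := by
  obtain ⟨S, hc, hS, rfl⟩ := h
  exact MeasurableSet.sUnion hc (fun B hB => (hS B hB).1)

lemma Small.union {Z X : Type*} [MeasurableSpace Z] {f : Z → X} {A B : Set Z}
    (hA : Small f A) (hB : Small f B) : Small f (A ∪ B) := by
  rw [union_eq_iUnion]
  exact Small.iUnion (fun b => by cases b <;> assumption)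

lemma Small.single {Z X : Type*} [MeasurableSpace Z] {f : Z → X} {B : Set Z}
    (hB : MeasurableSet B) (hi : InjOn f B) : Small f B :=
  ⟨{B}, countable_singleton _, by simp [hB, hi], by simp⟩

/-- Largeness of sets of sequences. -/
def Large {Z X : Type*} [MeasurableSpace Z] (f : Z → X) (H : Set (ℕ → Z)) : Prop :=
  ∀ A, Small f A → ∃ φ ∈ H, ∀ i, φ i ∉ A

lemma Large.exists_of_cover {Z X ι : Type*} [Countable ι] [MeasurableSpace Z] {f : Z → X}
    {H : Set (ℕ → Z)} (hH : Large f H) {K : ι → Set (ℕ → Z)} (hK : H ⊆ ⋃ j, K j) :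
    ∃ j, Large f (H ∩ K j) := by
  by_contra hcon
  push Not at hcon
  simp only [Large] at hcon
  push Not at hcon
  choose A hA hbad using hcon
  obtain ⟨φ, hφ, hav⟩ := hH _ (Small.iUnion hA)
  obtain ⟨j, hj⟩ := mem_iUnion.1 (hK hφ)
  obtain ⟨i, hi⟩ := hbad j φ ⟨hφ, hj⟩
  exact hav i (mem_iUnion.2 ⟨j, hi⟩)

section core

variable {Z X : Type*} [MetricSpace Z] [CompleteSpace Z] [SecondCountableTopology Z]
  [MeasurableSpace Z] [BorelSpace Z] [TopologicalSpace X] [T2Space X]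

/-- Analytic sets of injectivity are contained in Borel ones. -/
lemma exists_borel_inj {f : Z → X} (hf : Continuous f) {A : Set Z} (hA : AnalyticSet A)
    (hi : InjOn f A) : ∃ B, A ⊆ B ∧ MeasurableSet B ∧ InjOn f B := by
  have hG : MeasurableSet {p : Z × Z | p.1 ≠ p.2 ∧ f p.1 = f p.2} := by
    refine MeasurableSet.inter ?_ ?_
    · exact (isOpen_ne_fun continuous_fst continuous_snd).measurableSet
    · exact (isClosed_eq (hf.comp continuous_fst) (hf.comp continuous_snd)).measurableSet
  have hN : ∀ C : Set Z, AnalyticSet C →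
      AnalyticSet {z | ∃ a ∈ C, a ≠ z ∧ f a = f z} := by
    intro C hC
    have h1 : AnalyticSet ((Prod.fst ⁻¹' C) ∩ {p : Z × Z | p.1 ≠ p.2 ∧ f p.1 = f p.2}) :=
      analytic_inter (hC.preimage continuous_fst) hG.analyticSet
    convert h1.image_of_continuous continuous_snd using 1
    ext z
    simp
  obtain ⟨B1, hAB1, hd1, hm1⟩ := hA.measurablySeparable (hN A hA) (by
    rw [Set.disjoint_left]
    rintro z hz ⟨a, ha, hne, he⟩
    exact hne (hi ha hz he))
  obtain ⟨B2, hAB2, hd2, hm2⟩ := hA.measurablySeparable (hN B1 hm1.analyticSet) (by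
    rw [Set.disjoint_left]
    rintro z hz ⟨a, ha, hne, he⟩
    exact Set.disjoint_left.1 hd1 ⟨z, hz, hne.symm, he.symm⟩ ha)
  refine ⟨B1 ∩ B2, subset_inter hAB1 hAB2, hm1.inter hm2, ?_⟩
  intro a ha b hb hab
  by_contra hne
  exact Set.disjoint_left.1 hd2 ⟨a, ha.1, hne, hab⟩ hb.2

/-- `H` depends on the coordinates up to `n` only. -/
def Inv (n : ℕ) (H : Set (ℕ → Z)) : Prop :=
  ∀ φ ∈ H, ∀ φ' : ℕ → Z, (∀ i ≤ n, φ' i = φ i) → φ' ∈ H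

lemma split {f : Z → X} (hf : Continuous f) {n t : ℕ} (ht : t ≤ n) {H : Set (ℕ → Z)}
    (hH : AnalyticSet H) (hL : Large f H) (hI : Inv n H) :
    Large f {φ | φ ∈ H ∧ ∃ ψ ∈ H, φ (n+1) = ψ t ∧ φ t ≠ φ (n+1) ∧ f (φ t) = f (φ (n+1))} := by
  intro A hA
  have hm : MeasurableSet {φ : ℕ → Z | ∀ i, φ i ∉ A} := by
    rw [ofPred_forall]
    refine MeasurableSet.iInter fun i => ?_
    have h := (measurable_pi_apply (X := fun _ : ℕ => Z) i) hA.measurable.compl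
    exact h
  have hP : AnalyticSet ((fun φ : ℕ → Z => φ t) '' (H ∩ {φ : ℕ → Z | ∀ i, φ i ∉ A})) :=
    (analytic_inter hH hm.analyticSet).image_of_continuous (continuous_apply t)
  by_cases hinj : InjOn f ((fun φ : ℕ → Z => φ t) '' (H ∩ {φ : ℕ → Z | ∀ i, φ i ∉ A}))
  · exfalso
    obtain ⟨B, hPB, hBm, hBi⟩ := exists_borel_inj hf hP hinj
    obtain ⟨φ, hφ, hav⟩ := hL _ (hA.union (Small.single hBm hBi))
    exact hav t (Or.inr (hPB ⟨φ, ⟨hφ, fun i hi => hav i (Or.inl hi)⟩, rfl⟩))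
  · simp only [InjOn] at hinj
    push Not at hinj
    obtain ⟨_, ⟨φ, ⟨hφ, hφA⟩, rfl⟩, _, ⟨ψ, ⟨hψ, hψA⟩, rfl⟩, he, hne⟩ := hinj
    have h1 : Function.update φ (n+1) (ψ t) (n+1) = ψ t := by simp
    have h2 : Function.update φ (n+1) (ψ t) t = φ t :=
      Function.update_of_ne (by omega) _ _
    refine ⟨Function.update φ (n+1) (ψ t), ⟨?_, ψ, hψ, h1, ?_, ?_⟩, ?_⟩
    · exact hI φ hφ _ fun i hi => Function.update_of_ne (by omega) _ _
    · rw [h1, h2]; exact hne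
    · rw [h1, h2]; exact he
    · intro i
      by_cases hi : i = n + 1
      · subst hi; rw [h1]; exact hψA t
      · rw [Function.update_of_ne hi]; exact hφA i

lemma shrink {f : Z → X} {n : ℕ} {H : Set (ℕ → Z)}
    (hH : AnalyticSet H) (hL : Large f H) (hI : Inv n H) {ε : ℝ} (hε : 0 < ε) :
    ∃ H' ⊆ H, AnalyticSet H' ∧ Large f H' ∧ Inv n H' ∧
      ∀ φ ∈ H', ∀ ψ ∈ H', ∀ i ≤ n, dist (φ i) (ψ i) ≤ ε := by
  obtain ⟨s, hsc, hsd⟩ := TopologicalSpace.exists_countable_dense Z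
  have : Countable s := hsc.to_subtype
  have hcov : H ⊆ ⋃ j : Fin (n+1) → s,
      {φ : ℕ → Z | ∀ i : Fin (n+1), dist (φ i) (j i : Z) ≤ ε / 2} := by
    intro φ _
    have : ∀ i : Fin (n+1), ∃ y : s, dist (φ i) (y : Z) ≤ ε / 2 := by
      intro i
      obtain ⟨y, hy, hd⟩ := hsd.exists_dist_lt (φ i) (half_pos hε)
      exact ⟨⟨y, hy⟩, hd.le⟩
    choose j hj using this
    exact mem_iUnion.2 ⟨j, hj⟩
  obtain ⟨j, hj⟩ := hL.exists_of_cover hcov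
  refine ⟨_, inter_subset_left, analytic_inter hH ?_, hj, ?_, ?_⟩
  · have : IsClosed {φ : ℕ → Z | ∀ i : Fin (n+1), dist (φ i) (j i : Z) ≤ ε / 2} := by
      rw [ofPred_forall]
      exact isClosed_iInter fun i =>
        isClosed_le ((continuous_apply _).dist continuous_const) continuous_const
    exact this.analyticSet
  · rintro φ ⟨hφ, hφ2⟩ φ' he
    refine ⟨hI φ hφ φ' he, fun i => ?_⟩
    rw [he i (by omega)]
    exact hφ2 i
  · rintro φ ⟨_, hφ⟩ ψ ⟨_, hψ⟩ i hi
    have h1 := hφ ⟨i, by omega⟩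
    have h2 := hψ ⟨i, by omega⟩
    have h3 := dist_triangle_right (φ i) (ψ i) (j ⟨i, by omega⟩ : Z)
    simp only at h1 h2
    linarith

/-- The construction invariant. -/
def Good (f : Z → X) (n : ℕ) (H : Set (ℕ → Z)) : Prop :=
  AnalyticSet H ∧ Large f H ∧ Inv n H ∧
    ∀ φ ∈ H, ∀ ψ ∈ H, ∀ i ≤ n, dist (φ i) (ψ i) ≤ (1/2 : ℝ)^n

lemma step {f : Z → X} (hf : Continuous f) {n t : ℕ} (ht : t ≤ n) {H : Set (ℕ → Z)}
    (hG : Good f n H) : ∃ H' ⊆ H, Good f (n+1) H' ∧ ∃ δ > (0 : ℝ), ∀ φ ∈ H',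
      f (φ t) = f (φ (n+1)) ∧ δ ≤ dist (φ t) (φ (n+1)) ∧
        dist (φ t) (φ (n+1)) ≤ (1/2 : ℝ)^n := by
  obtain ⟨hH, hL, hI, hd⟩ := hG
  have hL1 := split hf ht hH hL hI
  set H1 := {φ | φ ∈ H ∧ ∃ ψ ∈ H, φ (n+1) = ψ t ∧ φ t ≠ φ (n+1) ∧ f (φ t) = f (φ (n+1))}
    with hH1
  have hA1 : AnalyticSet H1 := by
    have hm : MeasurableSet {p : (ℕ → Z) × (ℕ → Z) | p.1 (n+1) = p.2 t ∧ p.1 t ≠ p.1 (n+1) ∧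
        f (p.1 t) = f (p.1 (n+1))} := by
      refine MeasurableSet.inter ?_ (MeasurableSet.inter ?_ ?_)
      · exact (isClosed_eq (by fun_prop) (by fun_prop)).measurableSet
      · exact (isOpen_ne_fun (by fun_prop) (by fun_prop)).measurableSet
      · exact (isClosed_eq (by fun_prop) (by fun_prop)).measurableSet
    have h1 := analytic_inter (analytic_inter
      (hH.preimage (continuous_fst (X := ℕ → Z) (Y := ℕ → Z)))
      (hH.preimage (continuous_snd (X := ℕ → Z) (Y := ℕ → Z)))) hm.analyticSet
    convert h1.image_of_continuous continuous_fst using 1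
    ext φ
    simp only [hH1, mem_ofPred_eq, mem_image, mem_inter_iff, mem_preimage, Prod.exists]
    constructor
    · rintro ⟨a, ψ, b, c⟩
      exact ⟨φ, ψ, ⟨⟨a, b⟩, c⟩, rfl⟩
    · rintro ⟨φ, ψ, ⟨⟨a, b⟩, c⟩, rfl⟩
      exact ⟨a, ψ, b, c⟩
  have hI1 : Inv (n+1) H1 := by
    rintro φ ⟨hφ, ψ, hψ, h⟩ φ' he
    refine ⟨hI φ hφ φ' (fun i hi => he i (by omega)), ψ, hψ, ?_⟩
    rw [he (n+1) le_rfl, he t (by omega)]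
    exact h
  have hcov : H1 ⊆ ⋃ k : ℕ, {φ : ℕ → Z | 1 / ((k : ℝ) + 1) ≤ dist (φ t) (φ (n+1))} := by
    rintro φ ⟨hφ, ψ, hψ, h1, h2, h3⟩
    obtain ⟨k, hk⟩ := exists_nat_one_div_lt (dist_pos.2 h2)
    exact mem_iUnion.2 ⟨k, hk.le⟩
  obtain ⟨k, hk⟩ := hL1.exists_of_cover hcov
  have hcl : IsClosed {φ : ℕ → Z | 1 / ((k : ℝ) + 1) ≤ dist (φ t) (φ (n+1))} :=
    isClosed_le continuous_const (by fun_prop)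
  obtain ⟨H', hsub, h1, h2, h3, h4⟩ := shrink (n := n+1)
    (analytic_inter hA1 hcl.analyticSet) hk (by
      rintro φ ⟨hφ, hφ2⟩ φ' he
      refine ⟨hI1 φ hφ φ' he, ?_⟩
      simp only [mem_ofPred_eq] at hφ2 ⊢
      rw [he (n+1) le_rfl, he t (by omega)]
      exact hφ2) (ε := (1/2 : ℝ)^(n+1)) (by positivity)
  refine ⟨H', fun φ hφ => (hsub hφ).1.1, ⟨h1, h2, h3, h4⟩, 1 / ((k : ℝ) + 1), by positivity, ?_⟩
  intro φ hφ
  obtain ⟨⟨hφH, ψ, hψ, e1, e2, e3⟩, hδ⟩ := hsub hφ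
  refine ⟨e3, hδ, ?_⟩
  rw [e1]
  exact hd φ hφH ψ hψ t ht

lemma core {f : Z → X} (hf : Continuous f) (hc : ∀ x, (f ⁻¹' {x}).Countable) :
    Small f (univ : Set Z) := by
  by_contra hns
  have hL0 : Large f (univ : Set (ℕ → Z)) := by
    intro A hA
    have : A ≠ univ := fun h => hns (h ▸ hA)
    obtain ⟨z, hz⟩ := (ne_univ_iff_exists_notMem A).1 this
    exact ⟨fun _ => z, mem_univ _, fun _ => hz⟩
  obtain ⟨H0, -, hG0⟩ := shrink (n := 0) (MeasurableSet.univ.analyticSet) hL0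
    (fun _ _ _ _ => mem_univ _) (ε := (1/2 : ℝ)^0) (by positivity)
  let τ : ℕ → ℕ := fun n => (Nat.unpair n).1
  have hτ : ∀ n, τ n ≤ n := Nat.unpair_left_le
  choose! nxt hsub hgood δ hδ hprop using
    fun (n : ℕ) (H : Set (ℕ → Z)) (hG : Good f n H) => step hf (hτ n) hG
  let K : ℕ → Set (ℕ → Z) := fun n => Nat.rec H0 (fun n H => nxt n H) n
  have hKs : ∀ n, K (n+1) = nxt n (K n) := fun n => rfl
  have hKG : ∀ n, Good f n (K n) := by
    intro n
    induction n with
    | zero => exact hG0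
    | succ n ih => rw [hKs]; exact hgood n _ ih
  have hanti : Antitone K := antitone_nat_of_succ_le fun n => by
    rw [hKs]; exact hsub n _ (hKG n)
  have hne : ∀ n, (K n).Nonempty := fun n => by
    obtain ⟨φ, hφ, -⟩ := (hKG n).2.1 ∅ ⟨∅, countable_empty, by simp, by simp⟩
    exact ⟨φ, hφ⟩
  choose φ hφ using hne
  have hlim : ∀ i, ∃ z, Tendsto (fun n => φ n i) atTop (𝓝 z) := by
    intro i
    apply cauchySeq_tendsto_of_complete
    rw [Metric.cauchySeq_iff']
    intro ε hε
    obtain ⟨N, hN⟩ := exists_pow_lt_of_lt_one hε (by norm_num : (1/2 : ℝ) < 1)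
    refine ⟨max N i, fun n hn => ?_⟩
    refine lt_of_le_of_lt ((hKG (max N i)).2.2.2 _ (hanti hn (hφ n)) _ (hφ _) i
      (le_max_right _ _)) (lt_of_le_of_lt ?_ hN)
    exact pow_le_pow_of_le_one (by norm_num) (by norm_num) (le_max_left _ _)
  choose z hz using hlim
  have hev : ∀ m, ∀ᶠ n in atTop, f (φ n (τ m)) = f (φ n (m+1)) ∧
      δ m (K m) ≤ dist (φ n (τ m)) (φ n (m+1)) ∧
        dist (φ n (τ m)) (φ n (m+1)) ≤ (1/2 : ℝ)^m := by
    intro m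
    filter_upwards [eventually_ge_atTop (m+1)] with n hn
    exact hprop m _ (hKG m) _ (by rw [← hKs]; exact hanti hn (hφ n))
  have hfz : ∀ m, f (z (τ m)) = f (z (m+1)) := fun m =>
    tendsto_nhds_unique_of_eventuallyEq ((hf.tendsto _).comp (hz (τ m)))
      ((hf.tendsto _).comp (hz (m+1))) ((hev m).mono fun n h => h.1)
  have hzne : ∀ m, z (τ m) ≠ z (m+1) := fun m => by
    have h := ge_of_tendsto ((hz (τ m)).dist (hz (m+1))) ((hev m).mono fun n h => h.2.1)
    exact dist_pos.1 (lt_of_lt_of_le (hδ m _ (hKG m)) h)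
  have hzd : ∀ m, dist (z (τ m)) (z (m+1)) ≤ (1/2 : ℝ)^m := fun m =>
    le_of_tendsto ((hz (τ m)).dist (hz (m+1))) ((hev m).mono fun n h => h.2.2)
  have hfib : ∀ m, f (z m) = f (z 0) := by
    intro m
    induction m using Nat.strong_induction_on with
    | _ m ih =>
      cases m with
      | zero => rfl
      | succ m => rw [← hfz m]; exact ih _ (Nat.lt_succ_of_le (hτ m))
  have hpre : Preperfect (range z) := by
    rw [preperfect_iff_nhds]
    rintro _ ⟨i, rfl⟩ U hU
    obtain ⟨ε, hε, hb⟩ := Metric.mem_nhds_iff.1 hU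
    obtain ⟨N, hN⟩ := exists_pow_lt_of_lt_one hε (by norm_num : (1/2 : ℝ) < 1)
    have hp : τ (Nat.pair i N) = i := by simp [τ]
    have h1 := hzne (Nat.pair i N)
    have h2 := hzd (Nat.pair i N)
    rw [hp] at h1 h2
    refine ⟨z (Nat.pair i N + 1), ⟨hb ?_, mem_range_self _⟩, h1.symm⟩
    rw [Metric.mem_ball, dist_comm]
    refine lt_of_le_of_lt h2 (lt_of_le_of_lt ?_ hN)
    exact pow_le_pow_of_le_one (by norm_num) (by norm_num) (Nat.right_le_pair _ _)
  obtain ⟨g, hg, -, hginj⟩ := hpre.perfect_closure.exists_nat_bool_injection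
    ((range_nonempty z).closure)
  have hcl : closure (range z) ⊆ f ⁻¹' {f (z 0)} :=
    closure_minimal (by rintro _ ⟨i, rfl⟩; exact hfib i) (isClosed_singleton.preimage hf)
  have hcount : (range g).Countable := (hc (f (z 0))).mono (hg.trans hcl)
  have : Countable (ℕ → Bool) := by
    rw [← image_univ] at hcount
    exact countable_univ_iff.1 (countable_of_injective_of_countable_image hginj.injOn hcount)
  obtain ⟨e, he⟩ := exists_surjective_nat (ℕ → Bool)
  obtain ⟨n, hn⟩ := he (fun k => !(e k k))
  have hnn := congrFun hn n
  simp at hnn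

end core

lemma lusinNovikov {Z X : Type*} [MeasurableSpace Z] [StandardBorelSpace Z]
    [TopologicalSpace X] [PolishSpace X] [MeasurableSpace X] [BorelSpace X]
    {f : Z → X} (hf : Measurable f) (hc : ∀ x, (f ⁻¹' {x}).Countable) :
    Small f (univ : Set Z) := by
  letI up := upgradeStandardBorel Z
  have hpol0 : @PolishSpace Z up.toTopologicalSpace := inferInstance
  have hb0 : @BorelSpace Z up.toTopologicalSpace _ := inferInstance
  obtain ⟨t', hle, hcont, hpol⟩ := hf.exists_continuous
  have hb : @BorelSpace Z t' _ := by
    refine @BorelSpace.mk Z t' _ ?_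
    rw [MeasureTheory.borel_eq_borel_of_le hpol hpol0 hle]
    exact hb0.measurable_eq
  clear hle
  letI := @TopologicalSpace.upgradeIsCompletelyMetrizable Z t' _
  have := hpol.toSecondCountableTopology
  exact core hcont hc

end FMQ

/-- **Feldman–Moore for quasi-orders.** If `Q` is a countable Borel quasi-order on a
Polish space `X`, there is a countable monoid `M` acting on `X` in a Borel way such that
`x Q y ↔ ∃ m, x = m • y`. -/
theorem feldmanMoore_quasiOrder
    (X : Type) [TopologicalSpace X] [PolishSpace X]
    [MeasurableSpace X] [BorelSpace X]
    (Q : X → X → Prop)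
    (hrefl : ∀ x, Q x x)
    (htrans : ∀ x y z, Q x y → Q y z → Q x z)
    (hBorel : MeasurableSet {p : X × X | Q p.1 p.2})
    (hctble : ∀ x, {y | Q y x}.Countable) :
    ∃ (M : Type) (_ : Monoid M) (_ : Countable M) (act : M → X → X),
      (∀ m : M, Measurable (act m)) ∧
      (∀ x : X, act 1 x = x) ∧
      (∀ (m n : M) (x : X), act m (act n x) = act (m * n) x) ∧
      (∀ x y : X, Q x y ↔ ∃ m : M, x = act m y) := by
  classical
  haveI : StandardBorelSpace {p : X × X | Q p.1 p.2} := hBorel.standardBorel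
  let Z := {p : X × X | Q p.1 p.2}
  let f : Z → X := fun p => p.1.2
  let g : Z → X := fun p => p.1.1
  have hf : Measurable f := measurable_snd.comp measurable_subtype_coe
  have hg : Measurable g := measurable_fst.comp measurable_subtype_coe
  have hc : ∀ x, (f ⁻¹' {x}).Countable := by
    intro x
    refine countable_of_injective_of_countable_image (f := g) ?_ ((hctble x).mono ?_)
    · rintro ⟨⟨a, b⟩, h⟩ hb ⟨⟨a', b'⟩, h'⟩ hb' he
      simp only [f, g, mem_preimage, mem_singleton_iff] at hb hb' he
      subst hb hb' he
      rfl
    · rintro _ ⟨⟨⟨a, b⟩, h⟩, hb, rfl⟩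
      simp only [f, g, mem_preimage, mem_singleton_iff] at hb ⊢
      subst hb
      exact h
  obtain ⟨S, hSc, hS, hSu⟩ := FMQ.lusinNovikov hf hc
  haveI : Countable S := hSc.to_subtype
  let F : S → X → X := fun B y => if h : ∃ p ∈ B.1, f p = y then g h.choose else y
  have hF : ∀ (B : S) (p : Z), p ∈ B.1 → F B (f p) = g p := by
    intro B p hp
    have h : ∃ q ∈ B.1, f q = f p := ⟨p, hp, rfl⟩
    have : F B (f p) = g h.choose := dif_pos h
    rw [this, (hS B.1 B.2).2 h.choose_spec.1 hp h.choose_spec.2]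
  have hF' : ∀ (B : S) (y : X), y ∉ f '' B.1 → F B y = y := fun B y hy => dif_neg hy
  have hFm : ∀ B, Measurable (F B) := by
    intro B s hs
    have himg : ∀ C : Set Z, MeasurableSet C → C ⊆ B.1 → MeasurableSet (f '' C) :=
      fun C hC hCB => hC.image_of_measurable_injOn hf ((hS B.1 B.2).2.mono hCB)
    have : F B ⁻¹' s = f '' (B.1 ∩ g ⁻¹' s) ∪ (s \ f '' B.1) := by
      ext y
      by_cases hy : y ∈ f '' B.1
      · obtain ⟨p, hp, rfl⟩ := hy
        rw [mem_preimage, hF B p hp]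
        constructor
        · intro h
          exact Or.inl ⟨p, ⟨hp, h⟩, rfl⟩
        · rintro (⟨q, ⟨hq, hqs⟩, he⟩ | h)
          · rw [← (hS B.1 B.2).2 hq hp he]; exact hqs
          · exact absurd ⟨p, hp, rfl⟩ h.2
      · rw [mem_preimage, hF' B y hy]
        constructor
        · exact fun h => Or.inr ⟨h, hy⟩
        · rintro (⟨q, ⟨hq, hqs⟩, he⟩ | h)
          · exact absurd ⟨q, hq, he⟩ hy
          · exact h.1
    rw [this]
    exact (himg _ ((hS B.1 B.2).1.inter (hg hs)) inter_subset_left).union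
      (hs.diff (himg _ (hS B.1 B.2).1 Subset.rfl))
  have hFQ : ∀ B y, Q (F B y) y := by
    intro B y
    by_cases hy : y ∈ f '' B.1
    · obtain ⟨p, hp, rfl⟩ := hy
      rw [hF B p hp]
      exact p.2
    · rw [hF' B y hy]; exact hrefl y
  let G : Submonoid (Function.End X) :=
    { carrier := {h | Measurable h ∧ ∀ y, Q (h y) y}
      one_mem' := ⟨measurable_id, hrefl⟩
      mul_mem' := fun {a b} ha hb =>
        ⟨ha.1.comp hb.1, fun y => htrans _ _ _ (ha.2 (b y)) (hb.2 y)⟩ }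
  let ρ : FreeMonoid S →* G := FreeMonoid.lift fun B => ⟨F B, hFm B, hFQ B⟩
  have hctM : Countable (FreeMonoid S) := inferInstanceAs (Countable (List S))
  refine ⟨FreeMonoid S, inferInstance, hctM, fun m => (ρ m : Function.End X), fun m => (ρ m).2.1,
    fun x => by simp; rfl, fun m n x => by simp; rfl, fun x y => ⟨fun h => ?_, ?_⟩⟩
  · have : (⟨(x, y), h⟩ : Z) ∈ ⋃₀ S := hSu ▸ mem_univ _
    obtain ⟨B, hB, hp⟩ := this
    refine ⟨FreeMonoid.of ⟨B, hB⟩, ?_⟩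
    have := hF ⟨B, hB⟩ _ hp
    simp only [ρ, FreeMonoid.lift_eval_of]
    exact this.symm
  · rintro ⟨m, rfl⟩
    exact (ρ m).2.2 y
end

section
/- With f defined as in the recursive definition on {a,b,c,d}^{<ℕ} into subsets of the free group F_∞: if some element of f(u) has freely reduced form beginning with the generator x_w, then w is an initial segment of u; moreover if γ ∈ f(u) starts with x_w w and u = w⌢t, then γ = x_w w λ with λ ∈ f(t). -/
/-- Generators of `F_∞`: the four letters `a,b,c,d` (as `Fin 4`) together with a
generator `x_w` for each nonempty word `w ∈ {a,b,c,d}^{<ℕ}`. -/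
abbrev FGen := Fin 4 ⊕ {w : List (Fin 4) // w ≠ []}

/-- The image of a word `w ∈ {a,b,c,d}^{<ℕ}` in the free group `F_∞`. -/
def wordEmb (w : List (Fin 4)) : FreeGroup FGen :=
  (w.map (fun i => FreeGroup.of (Sum.inl i))).prod

/-- The generator `x_w` for a nonempty word `w`. -/
def xGen (w : List (Fin 4)) (h : w ≠ []) : FreeGroup FGen :=
  FreeGroup.of (Sum.inr ⟨w, h⟩)

/-- Fuel-based version of the recursive definition of `f`. -/
def fencAux : ℕ → List (Fin 4) → Set (FreeGroup FGen)
  | 0, w => if w = [] then {1} else ∅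
  | n + 1, w =>
    if hw : w = [] then {1}
    else if w.length = 1 then {wordEmb w, xGen w hw * wordEmb w}
    else
      {g | ∃ s t : List (Fin 4), s ≠ [] ∧ t ≠ [] ∧ w = s ++ t ∧
          ∃ p ∈ fencAux n s, ∃ q ∈ fencAux n t, g = p * q} ∪
        {xGen w hw * wordEmb w}

/-- The recursively defined encoding `f : {a,b,c,d}^{<ℕ} → 𝒫(F_∞)`:
`f(e) = {e}`, `f(z) = {z, x_z z}` for letters `z`, and
`f(w) = (⋃_{w = s⌢t, s,t ≠ e} f(s)f(t)) ∪ {x_w w}` for longer words. -/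
def fenc (w : List (Fin 4)) : Set (FreeGroup FGen) :=
  fencAux w.length w


/-- Block structure of the elements of `f(u)` as positive words. -/
inductive BlockW : List (Fin 4) → List FGen → Prop
  | nil : BlockW [] []
  | letter (z : Fin 4) {u L} : BlockW u L → BlockW (z :: u) (Sum.inl z :: L)
  | block (w : List (Fin 4)) (hw : w ≠ []) {u L} : BlockW u L →
      BlockW (w ++ u) (Sum.inr ⟨w, hw⟩ :: (w.map Sum.inl ++ L))

/-- The positive word `L` as a free group element. -/
def posEmb (L : List FGen) : FreeGroup FGen := (L.map FreeGroup.of).prod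

theorem posEmb_append (L M : List FGen) : posEmb (L ++ M) = posEmb L * posEmb M := by
  simp [posEmb]

theorem posEmb_cons (x : FGen) (M : List FGen) :
    posEmb (x :: M) = FreeGroup.of x * posEmb M := by
  simp [posEmb]

theorem posEmb_toWord (L : List FGen) : (posEmb L).toWord = L.map (fun x => (x, true)) := by
  have h : posEmb L = FreeGroup.mk (L.map (fun x => (x, true))) := by
    induction L with
    | nil => rfl
    | cons x L ih => rw [posEmb_cons, ih]; rfl
  rw [h, FreeGroup.toWord_mk]
  apply FreeGroup.IsReduced.reduce_eq
  unfold FreeGroup.IsReduced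
  clear h
  apply List.Pairwise.isChain
  rw [List.pairwise_map]
  exact List.pairwise_of_forall (by simp)

theorem wordEmb_eq (w : List (Fin 4)) : wordEmb w = posEmb (w.map Sum.inl) := by
  simp [wordEmb, posEmb, Function.comp_def]

theorem xw_eq (w : List (Fin 4)) (hw : w ≠ []) :
    xGen w hw * wordEmb w = posEmb (Sum.inr ⟨w, hw⟩ :: w.map Sum.inl) := by
  rw [posEmb_cons, wordEmb_eq, xGen]

theorem BlockW.append {u v : List (Fin 4)} {L M : List FGen} (h : BlockW u L)
    (h' : BlockW v M) : BlockW (u ++ v) (L ++ M) := by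
  induction h with
  | nil => simpa using h'
  | letter z _ ih => exact .letter z ih
  | block w hw _ ih => simpa using BlockW.block w hw ih

theorem BlockW.nil_right {u : List (Fin 4)} {L : List FGen} (h : BlockW u L) (hu : u = []) :
    L = [] := by
  cases h with
  | nil => rfl
  | letter z _ => simp at hu
  | block w hw _ => simp [hw] at hu

theorem BlockW.single (w : List (Fin 4)) (hw : w ≠ []) :
    BlockW w (Sum.inr ⟨w, hw⟩ :: w.map Sum.inl) := by
  simpa using BlockW.block w hw .nil

theorem fencAux_block (n : ℕ) : ∀ (u : List (Fin 4)) (g : FreeGroup FGen), g ∈ fencAux n u →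
    ∃ L, BlockW u L ∧ g = posEmb L := by
  induction n with
  | zero =>
    intro u g h
    unfold fencAux at h
    split_ifs at h with hu
    · subst hu; exact ⟨[], .nil, h⟩
    · exact h.elim
  | succ n ih =>
    intro u g h
    unfold fencAux at h
    split_ifs at h with hu h1
    · subst hu; exact ⟨[], .nil, h⟩
    · rcases h with h | h
      · obtain ⟨z, rfl⟩ := List.length_eq_one_iff.1 h1
        exact ⟨_, .letter z .nil, by rw [h, wordEmb_eq]; rfl⟩
      · exact ⟨_, .single u hu, by rw [← xw_eq]; exact h⟩
    · rcases h with ⟨s, t, _, _, rfl, p, hp, q, hq, rfl⟩ | h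
      · obtain ⟨L, hL, rfl⟩ := ih _ _ hp
        obtain ⟨M, hM, rfl⟩ := ih _ _ hq
        exact ⟨_, hL.append hM, (posEmb_append _ _).symm⟩
      · exact ⟨_, .single u hu, by rw [← xw_eq]; exact h⟩

theorem fencAux_mul (n : ℕ) (s t : List (Fin 4)) (hs : s ≠ []) (ht : t ≠ [])
    (p q : FreeGroup FGen) (hp : p ∈ fencAux n s) (hq : q ∈ fencAux n t) :
    p * q ∈ fencAux (n + 1) (s ++ t) := by
  have h1 := List.length_pos_iff.2 hs
  have h2 := List.length_pos_iff.2 ht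
  unfold fencAux
  rw [dif_neg (by simp [hs]), if_neg (by simp; omega)]
  exact Or.inl ⟨s, t, hs, ht, rfl, p, hp, q, hq, rfl⟩

theorem fencAux_single (n : ℕ) (w : List (Fin 4)) (hw : w ≠ []) :
    xGen w hw * wordEmb w ∈ fencAux (n + 1) w := by
  unfold fencAux
  rw [dif_neg hw]
  split_ifs
  · exact Or.inr rfl
  · exact Or.inr rfl

theorem fencAux_letter (n : ℕ) (z : Fin 4) : wordEmb [z] ∈ fencAux (n + 1) [z] := by
  unfold fencAux
  rw [dif_neg (by simp), if_pos (by simp)]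
  exact Or.inl rfl

theorem block_fencAux {u : List (Fin 4)} {L : List FGen} (h : BlockW u L) :
    ∀ n, u.length ≤ n → posEmb L ∈ fencAux n u := by
  induction h with
  | nil => intro n _; cases n <;> simp [fencAux, posEmb]
  | @letter z u L h ih =>
    intro n hn
    have e : posEmb (Sum.inl z :: L) = wordEmb [z] * posEmb L := by
      rw [posEmb_cons]; simp [wordEmb]
    simp only [List.length_cons] at hn
    obtain ⟨n, rfl⟩ : ∃ m, n = m + 1 := ⟨n - 1, by omega⟩
    by_cases hu : u = []
    · rw [e, h.nil_right hu, hu]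
      simpa [posEmb] using fencAux_letter n z
    · have := List.length_pos_iff.2 hu
      rw [e]
      obtain ⟨m, rfl⟩ : ∃ m, n = m + 1 := ⟨n - 1, by omega⟩
      exact fencAux_mul _ [z] u (by simp) hu _ _ (fencAux_letter m z) (ih _ (by omega))
  | @block w hw u L h ih =>
    intro n hn
    have e : posEmb (Sum.inr ⟨w, hw⟩ :: (w.map Sum.inl ++ L)) =
        xGen w hw * wordEmb w * posEmb L := by
      rw [xw_eq, ← posEmb_append]; rfl
    simp only [List.length_append] at hn
    have hl := List.length_pos_iff.2 hw
    obtain ⟨n, rfl⟩ : ∃ m, n = m + 1 := ⟨n - 1, by omega⟩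
    by_cases hu : u = []
    · rw [e, h.nil_right hu, hu]
      simpa [posEmb] using fencAux_single n w hw
    · have := List.length_pos_iff.2 hu
      rw [e]
      obtain ⟨m, rfl⟩ : ∃ m, n = m + 1 := ⟨n - 1, by omega⟩
      exact fencAux_mul _ w u hw hu _ _ (fencAux_single m w hw) (ih _ (by omega))

theorem BlockW.head {u w : List (Fin 4)} {hw : w ≠ []} {L : List FGen} (h : BlockW u L)
    (hh : L.head? = some (Sum.inr ⟨w, hw⟩)) :
    ∃ t M, u = w ++ t ∧ BlockW t M ∧ L = Sum.inr ⟨w, hw⟩ :: (w.map Sum.inl ++ M) := by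
  cases h with
  | nil => simp at hh
  | letter z _ => simp at hh
  | @block w' hw' u L h =>
    simp only [List.head?_cons, Option.some.injEq, Sum.inr.injEq, Subtype.mk.injEq] at hh
    subst hh
    exact ⟨_, _, rfl, h, rfl⟩

/-- (a) If some element of `f(u)` has freely reduced form beginning with the generator
`x_w`, then `w` is an initial segment of `u`.  (b) If `γ ∈ f(u)` starts with `x_w w` and
`u = w⌢t`, then `γ = x_w w λ` with `λ ∈ f(t)`. -/
theorem fenc_initial_segment :
    (∀ (u w : List (Fin 4)) (hw : w ≠ []) (g : FreeGroup FGen), g ∈ fenc u →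
      g.toWord.head? = some (Sum.inr ⟨w, hw⟩, true) → w <+: u) ∧
    (∀ (w t : List (Fin 4)) (hw : w ≠ []) (γ : FreeGroup FGen), γ ∈ fenc (w ++ t) →
      γ.toWord.take (1 + w.length) = (xGen w hw * wordEmb w).toWord →
      ∃ lam ∈ fenc t, γ = xGen w hw * wordEmb w * lam) := by
  constructor
  · intro u w hw g hg hh
    obtain ⟨L, hL, rfl⟩ := fencAux_block _ _ _ hg
    rw [posEmb_toWord] at hh
    have hh' : L.head? = some (Sum.inr ⟨w, hw⟩) := by
      cases L with
      | nil => simp at hh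
      | cons x L => simpa using hh
    obtain ⟨t, M, rfl, -, -⟩ := hL.head hh'
    exact List.prefix_append _ _
  · intro w t hw g hg hh
    obtain ⟨L, hL, rfl⟩ := fencAux_block _ _ _ hg
    rw [xw_eq, posEmb_toWord, posEmb_toWord] at hh
    have hh' : L.head? = some (Sum.inr ⟨w, hw⟩) := by
      cases L with
      | nil => simp at hh
      | cons x L =>
        rw [Nat.add_comm] at hh
        simp only [List.map_cons, List.take_succ_cons, List.cons.injEq, Prod.mk.injEq] at hh
        simpa using hh.1
    obtain ⟨t', M, ht, hM, rfl⟩ := hL.head hh'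
    obtain rfl := List.append_cancel_left ht
    refine ⟨posEmb M, block_fencAux hM _ le_rfl, ?_⟩
    rw [xw_eq, ← posEmb_append]; rfl
end
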